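/- Let G be a finite multigraph with a linear order on its edges and t ≥ 1 an integer. The map sending a t-labeled forest F of G (with label ℓ(e) on each edge e ∈ F) to the edge set F' = { e_{ℓ(e)} : e ∈ F } of Ĝ is a bijection between the t-labeled forests of G and the subforests of Ĝ, and under this bijection act_Ĝ(F') = t·act_G(F) + ω(F) − |F|. In particular, the number of t-labeled forests of G equals the number of subforests of Ĝ. -/

import Mathlib

open MvPolynomial

namespace ForestAlg

variable {V E : Type*}

/-- Two vertices are directly connected by an edge of `A`. -/
def edgeRel (ends : E → Sym2 V) (A : Finset E) (v w : V) : Prop :=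
  ∃ e ∈ A, ends e = s(v, w)

/-- Number of connected components of the spanning subgraph `(V, A)`. -/
noncomputable def numComponents (ends : E → Sym2 V) (A : Finset E) : ℕ :=
  Nat.card (Quot (edgeRel ends A))

/-- Rank `r(A) = v(G) - c(V,A)`. -/
noncomputable def rank (ends : E → Sym2 V) (A : Finset E) : ℕ :=
  Nat.card V - numComponents ends A

/-- `A` is a subforest (contains no cycle): `|A| = v(G) - c(V,A)`. -/
def IsForest (ends : E → Sym2 V) (A : Finset E) : Prop :=
  A.card + numComponents ends A = Nat.card V

/-- The Tutte polynomial, evaluated at `(x, y)`. -/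
noncomputable def tutte [Fintype E] {R : Type*} [CommRing R]
    (ends : E → Sym2 V) (x y : R) : R :=
  ∑ A ∈ (Finset.univ : Finset E).powerset,
    (x - 1) ^ (rank ends Finset.univ - rank ends A) *
      (y - 1) ^ (A.card - rank ends A)

/-- `e ∉ F` is externally active for the subforest `F` with respect to the linear
order `o`: `F + e` contains a cycle and `e` is the minimal edge of that cycle
(the edges of the unique cycle of `F + e` are those whose removal does not
decrease the rank). -/
def ExtActive [DecidableEq E] (o : LinearOrder E) (ends : E → Sym2 V)
    (F : Finset E) (e : E) : Prop :=
  e ∉ F ∧ ¬ IsForest ends (insert e F) ∧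
    ∀ f ∈ insert e F,
      rank ends ((insert e F).erase f) = rank ends (insert e F) → o.le e f

/-- External activity `act_G(F)`. -/
noncomputable def act [DecidableEq E] (o : LinearOrder E) (ends : E → Sym2 V)
    (F : Finset E) : ℕ :=
  Set.ncard {e : E | ExtActive o ends F e}

/-- `D_I`: number of edges with one endpoint in `I` and the other outside `I`. -/
noncomputable def crossCount {n : ℕ} (ends : E → Sym2 (Fin n))
    (I : Finset (Fin n)) : ℕ :=
  Set.ncard {e : E | (∃ v ∈ ends e, v ∈ I) ∧ ∃ w ∈ ends e, w ∉ I}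

/-- The ideal `J_G^{F_t}` generated by `(∑_{i ∈ I} x_i)^{t·D_I + 1}` over nonempty `I`. -/
noncomputable def forestIdeal (K : Type*) [Field K] {n : ℕ} (t : ℕ)
    (ends : E → Sym2 (Fin n)) : Ideal (MvPolynomial (Fin n) K) :=
  Ideal.span {p | ∃ I : Finset (Fin n), I.Nonempty ∧
    p = (∑ i ∈ I, X i) ^ (t * crossCount ends I + 1)}

/-- The `k`-th graded component of `K[x_1,…,x_n]/J` (for homogeneous `J`):
the image of the degree-`k` homogeneous part in the quotient. -/
noncomputable def gradedPiece (K : Type*) [Field K] {n : ℕ}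
    (J : Ideal (MvPolynomial (Fin n) K)) (k : ℕ) :
    Submodule K (MvPolynomial (Fin n) K ⧸ J) :=
  Submodule.map (Ideal.Quotient.mkₐ K J).toLinearMap
    (homogeneousSubmodule (Fin n) K k)

/-- Dimension of the `k`-th graded component of the quotient. -/
noncomputable def gradedDim (K : Type*) [Field K] {n : ℕ}
    (J : Ideal (MvPolynomial (Fin n) K)) (k : ℕ) : ℕ :=
  Module.finrank K (gradedPiece K J k)


/-- A `t`-labeled forest of `G`: a subforest together with a label in `{1,…,t}`
on each of its edges (the labelling function is `0` off the forest). -/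
def LabeledForest (ends : E → Sym2 V) (t : ℕ) : Type _ :=
  {Fl : Finset E × (E → ℕ) // IsForest ends Fl.1 ∧
    (∀ e ∈ Fl.1, 1 ≤ Fl.2 e ∧ Fl.2 e ≤ t) ∧ ∀ e ∉ Fl.1, Fl.2 e = 0}

/-- The weight `ω(F)` of a `t`-labeled forest: the sum of the labels of its
edges. -/
def weight {t : ℕ} {ends : E → Sym2 V} (F : LabeledForest ends t) : ℕ :=
  ∑ e ∈ F.val.1, F.val.2 e

/-- The underlying subforest of a `t`-labeled forest. -/
def LabeledForest.edges {t : ℕ} {ends : E → Sym2 V} (F : LabeledForest ends t) :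
    Finset E :=
  F.val.1

section Components

variable {V E E' : Type*}

/-- The number of components only depends on the set of endpoint pairs, so it is unchanged
when parallel edges are identified. -/
lemma numComponents_comp [DecidableEq E] (ends : E → Sym2 V) (π : E' → E) (A : Finset E') :
    numComponents (ends ∘ π) A = numComponents ends (A.image π) := by
  have h : edgeRel (ends ∘ π) A = edgeRel ends (A.image π) := by
    funext v w
    simp [edgeRel]
  simp only [numComponents, h]

lemma numComponents_empty (ends : E → Sym2 V) : numComponents ends ∅ = Nat.card V := by
  refine (Nat.card_congr
    (Equiv.ofBijective (Quot.mk (edgeRel ends ∅)) ⟨?_, Quot.mk_surjective⟩)).symm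
  intro a b h
  exact congrArg (Quot.lift id fun a b ⟨e, he, _⟩ => absurd he (Finset.notMem_empty e)) h

lemma numComponents_le_card [Finite V] (ends : E → Sym2 V) (A : Finset E) :
    numComponents ends A ≤ Nat.card V :=
  Nat.card_le_card_of_surjective _ Quot.mk_surjective

lemma numComponents_le_insert [Finite V] [DecidableEq E] (ends : E → Sym2 V) (e : E)
    (A : Finset E) : numComponents ends A ≤ numComponents ends (insert e A) + 1 := by
  classical
  obtain ⟨v, w, hvw⟩ : ∃ v w, ends e = s(v, w) := by
    induction h : ends e with
    | h v w => exact ⟨v, w, rfl⟩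
  let mk : V → Quot (edgeRel ends A) := Quot.mk _
  let g : Quot (edgeRel ends (insert e A)) → Quot (edgeRel ends A) :=
    Quot.lift (fun x => if mk x = mk w then mk v else mk x) (by
      rintro a b ⟨f, hf, hab⟩
      rcases Finset.mem_insert.1 hf with rfl | hf
      · rw [hvw, Sym2.eq_iff] at hab
        rcases hab with ⟨rfl, rfl⟩ | ⟨rfl, rfl⟩ <;> simp
      · have h : mk a = mk b := Quot.sound ⟨f, hf, hab⟩
        simp only [h])
  let k : Option (Quot (edgeRel ends (insert e A))) → Quot (edgeRel ends A) :=
    fun o => o.elim (mk w) g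
  have hk : Function.Surjective k := by
    intro q
    obtain ⟨x, rfl⟩ := Quot.mk_surjective q
    by_cases hx : mk x = mk w
    · exact ⟨none, hx.symm⟩
    · exact ⟨some (Quot.mk _ x), if_neg hx⟩
  simpa [numComponents, Finite.card_option] using Nat.card_le_card_of_surjective k hk

lemma card_le_card_add_numComponents [Finite V] (ends : E → Sym2 V) (A : Finset E) :
    Nat.card V ≤ A.card + numComponents ends A := by
  classical
  induction A using Finset.induction_on with
  | empty => simp [numComponents_empty]
  | insert e A he ih =>
    have := numComponents_le_insert ends e A
    rw [Finset.card_insert_of_notMem he]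
    omega

lemma rank_eq_rank_iff [Finite V] (ends : E → Sym2 V) (A B : Finset E) :
    rank ends A = rank ends B ↔ numComponents ends A = numComponents ends B := by
  have := numComponents_le_card ends A
  have := numComponents_le_card ends B
  unfold rank
  omega

lemma IsForest.numComponents_erase_ne [Finite V] [DecidableEq E] {ends : E → Sym2 V}
    {A : Finset E} (hA : IsForest ends A) {e : E} (he : e ∈ A) :
    numComponents ends (A.erase e) ≠ numComponents ends A := by
  have h₁ := card_le_card_add_numComponents ends (A.erase e)
  have h₂ := Finset.card_erase_add_one he
  unfold IsForest at hA
  omega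

/-- A forest contains no two parallel edges. -/
lemma IsForest.injOn_of_comp [Finite V] {ends : E → Sym2 V} {π : E' → E} {A : Finset E'}
    (hA : IsForest (ends ∘ π) A) : Set.InjOn π A := by
  classical
  intro p hp q hq hpq
  by_contra hne
  refine hA.numComponents_erase_ne hq ?_
  rw [numComponents_comp, numComponents_comp]
  congr 1
  refine (Finset.image_subset_image (Finset.erase_subset _ _)).antisymm ?_
  intro x hx
  obtain ⟨r, hr, rfl⟩ := Finset.mem_image.1 hx
  by_cases hrq : r = q
  · exact Finset.mem_image.2 ⟨p, Finset.mem_erase.2 ⟨hne, hp⟩, by rw [hrq, hpq]⟩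
  · exact Finset.mem_image_of_mem _ (Finset.mem_erase.2 ⟨hrq, hr⟩)

lemma isForest_comp_iff [DecidableEq E] {ends : E → Sym2 V} {π : E' → E} {A : Finset E'}
    (hA : Set.InjOn π A) : IsForest (ends ∘ π) A ↔ IsForest ends (A.image π) := by
  rw [IsForest, IsForest, numComponents_comp, Finset.card_image_of_injOn hA]

lemma image_erase_of_injOn [DecidableEq E] [DecidableEq E'] {π : E' → E} {A : Finset E'}
    (hA : Set.InjOn π A) {q : E'} (hq : q ∈ A) : (A.erase q).image π = (A.image π).erase (π q) := by
  ext x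
  simp only [Finset.mem_image, Finset.mem_erase]
  constructor
  · rintro ⟨r, ⟨hrq, hr⟩, rfl⟩
    exact ⟨fun h => hrq (hA hr hq h), r, hr, rfl⟩
  · rintro ⟨hx, r, hr, rfl⟩
    exact ⟨r, ⟨fun h => hx (h ▸ rfl), hr⟩, rfl⟩

/-- External activity of an edge parallel to an edge of the forest. -/
lemma extActive_comp_iff_of_mem_image [Finite V] [DecidableEq E] [DecidableEq E']
    (o : LinearOrder E') {ends : E → Sym2 V} {π : E' → E} {A : Finset E'}
    (hinj : Set.InjOn π A) (hA : IsForest ends (A.image π)) {p q : E'} (hp : p ∉ A)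
    (hq : q ∈ A) (hpq : π q = π p) :
    ExtActive o (ends ∘ π) A p ↔ o.le p q := by
  have hAf := (isForest_comp_iff hinj).2 hA
  have himage : (insert p A).image π = A.image π := by
    rw [Finset.image_insert, Finset.insert_eq_self, ← hpq]
    exact Finset.mem_image_of_mem _ hq
  unfold ExtActive
  simp only [rank_eq_rank_iff]
  constructor
  · rintro ⟨-, -, h⟩
    refine h q (Finset.mem_insert_of_mem hq) ?_
    have hqp : p ≠ q := fun h => hp (h ▸ hq)
    rw [Finset.erase_insert_of_ne hqp, numComponents_comp, numComponents_comp, himage,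
      Finset.image_insert, image_erase_of_injOn hinj hq, ← hpq,
      Finset.insert_erase (Finset.mem_image_of_mem _ hq)]
  · refine fun hle => ⟨hp, fun hf => ?_, fun f hf heq => ?_⟩
    · exact hp (hf.injOn_of_comp (by simp) (by simp [hq]) hpq.symm ▸ hq)
    · rcases Finset.mem_insert.1 hf with rfl | hf
      · exact o.le_refl _
      · by_cases hfq : f = q
        · exact hfq ▸ hle
        · exfalso
          have hpf : p ≠ f := fun h => hp (h ▸ hf)
          rw [Finset.erase_insert_of_ne hpf, numComponents_comp, numComponents_comp, himage,
            Finset.image_insert, ← hpq, image_erase_of_injOn hinj hf, Finset.insert_eq_self.2] at heq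
          · exact hA.numComponents_erase_ne (Finset.mem_image_of_mem _ hf) heq
          · exact Finset.mem_erase.2
              ⟨fun h => hfq (hinj hf hq h.symm), Finset.mem_image_of_mem _ hq⟩

/-- External activity of an edge not parallel to any edge of the forest. -/
lemma extActive_comp_iff_of_notMem_image [Finite V] [DecidableEq E] [DecidableEq E']
    (o' : LinearOrder E') (o : LinearOrder E) {ends : E → Sym2 V} {π : E' → E}
    {A : Finset E'} (hinj : Set.InjOn π A) {p : E'} (hp : π p ∉ A.image π)
    (hmono : ∀ q, π q ≠ π p → (o'.le p q ↔ o.le (π p) (π q))) :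
    ExtActive o' (ends ∘ π) A p ↔ ExtActive o ends (A.image π) (π p) := by
  have hpA : p ∉ A := fun h => hp (Finset.mem_image_of_mem _ h)
  have hinj' : Set.InjOn π (insert p A : Finset E') := by
    rw [Finset.coe_insert, Set.injOn_insert (by simpa using hpA)]
    exact ⟨hinj, by simpa using hp⟩
  unfold ExtActive
  simp only [rank_eq_rank_iff]
  rw [isForest_comp_iff hinj', Finset.image_insert]
  simp only [hpA, hp, not_false_eq_true, true_and]
  refine and_congr_right fun _ => ?_
  rw [← Finset.image_insert, Finset.forall_mem_image]
  refine forall₂_congr fun q hq => ?_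
  rw [numComponents_comp, numComponents_comp, image_erase_of_injOn hinj' hq]
  refine imp_congr_right fun _ => ?_
  rcases Finset.mem_insert.1 hq with rfl | hq
  · exact iff_of_true (o'.le_refl _) (o.le_refl _)
  · exact hmono q fun h => hp (h ▸ Finset.mem_image_of_mem _ hq)

end Components

section Labels

variable {V E : Type*} [Fintype E] {t : ℕ}

/-- The set of clones `e_{ℓ(e)}` for `e` in `F`. -/
def clones [DecidableEq E] (t : ℕ) (F : Finset E) (l : E → ℕ) : Finset (E ×ₗ Fin t) :=
  Finset.univ.filter fun p => (ofLex p).1 ∈ F ∧ ((ofLex p).2 : ℕ) + 1 = l (ofLex p).1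

/-- The edge of `G` of which a given edge of `Ĝ` is a copy. -/
def cloneProj (p : E ×ₗ Fin t) : E := (ofLex p).1

lemma mem_clones [DecidableEq E] {F : Finset E} {l : E → ℕ} {p : E ×ₗ Fin t} :
    p ∈ clones t F l ↔ (ofLex p).1 ∈ F ∧ ((ofLex p).2 : ℕ) + 1 = l (ofLex p).1 := by
  simp [clones]

lemma clones_injOn [DecidableEq E] (F : Finset E) (l : E → ℕ) :
    Set.InjOn cloneProj (clones t F l : Set (E ×ₗ Fin t)) := by
  intro p hp q hq h
  rw [Finset.mem_coe, mem_clones] at hp hq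
  have h1 : (ofLex p).1 = (ofLex q).1 := h
  have h2 : (ofLex p).2 = (ofLex q).2 := Fin.ext (by rw [h1] at hp; omega)
  exact ofLex.injective (Prod.ext h1 h2)

lemma image_clones [DecidableEq E] {F : Finset E} {l : E → ℕ}
    (hl : ∀ e ∈ F, 1 ≤ l e ∧ l e ≤ t) : (clones t F l).image cloneProj = F := by
  ext e
  simp only [Finset.mem_image, mem_clones]
  constructor
  · rintro ⟨p, hp, rfl⟩
    exact hp.1
  · intro he
    obtain ⟨h1, h2⟩ := hl e he
    exact ⟨toLex (e, ⟨l e - 1, by omega⟩), ⟨he, Nat.sub_add_cancel h1⟩, rfl⟩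

/-- The number of externally active copies of a single edge `e`: all or none of them if `e` is
not in the forest, and those with a smaller label than `e` otherwise. -/
lemma card_extActive_clones [Finite V] [DecidableEq E] [DecidableEq (E ×ₗ Fin t)]
    [LinearOrder E] {ends : E → Sym2 V} {F : Finset E} {l : E → ℕ} (hF : IsForest ends F)
    (hl : ∀ e ∈ F, 1 ≤ l e ∧ l e ≤ t) (e : E) :
    Set.ncard {i : Fin t | ExtActive (inferInstance : LinearOrder (E ×ₗ Fin t))
        (ends ∘ cloneProj) (clones t F l) (toLex (e, i))} + (if e ∈ F then 1 else 0)
      = t * Set.ncard {_x : Unit | ExtActive inferInstance ends F e}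
        + (if e ∈ F then l e else 0) := by
  have himage := image_clones hl
  by_cases he : e ∈ F
  · obtain ⟨h1, h2⟩ := hl e he
    have hright : ¬ ExtActive inferInstance ends F e := fun h => h.1 he
    have hset : {i : Fin t | ExtActive (inferInstance : LinearOrder (E ×ₗ Fin t))
        (ends ∘ cloneProj) (clones t F l) (toLex (e, i))}
        = ((Finset.univ.filter fun i : Fin t => (i : ℕ) < l e - 1 : Finset (Fin t)) :
          Set (Fin t)) := by
      ext i
      simp only [Set.mem_ofPred_eq, Finset.coe_filter, Finset.mem_univ, true_and]
      by_cases hi : (i : ℕ) + 1 = l e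
      · exact iff_of_false (fun h => h.1 (mem_clones.2 ⟨he, hi⟩)) (by omega)
      · rw [extActive_comp_iff_of_mem_image _ (clones_injOn F l) (by rwa [himage])
          (p := toLex (e, i)) (q := toLex (e, ⟨l e - 1, by omega⟩))
          (fun h => hi (mem_clones.1 h).2) (mem_clones.2 ⟨he, Nat.sub_add_cancel h1⟩) rfl]
        refine (Prod.Lex.toLex_le_toLex).trans ?_
        simp only [lt_self_iff_false, true_and, false_or, Fin.le_def]
        omega
    rw [hset, Set.ncard_coe_finset, Fin.card_filter_val_lt]
    simp only [hright, he, if_true, Set.ofPred_false, Set.ncard_empty]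
    omega
  · have hiff : ∀ i : Fin t, ExtActive (inferInstance : LinearOrder (E ×ₗ Fin t))
        (ends ∘ cloneProj) (clones t F l) (toLex (e, i))
        ↔ ExtActive inferInstance ends F e := by
      intro i
      have hp : cloneProj (toLex (e, i)) ∉ (clones t F l).image cloneProj := by
        rwa [himage]
      rw [extActive_comp_iff_of_notMem_image _ inferInstance (clones_injOn F l) hp, himage]
      · rfl
      · intro q hq
        have hq' : e ≠ (ofLex q).1 := fun h => hq h.symm
        refine (Prod.Lex.le_iff).trans ?_
        simp only [ofLex_toLex, hq', false_and, or_false]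
        exact ⟨le_of_lt, fun h => lt_of_le_of_ne h hq'⟩
    simp only [hiff, he, if_false]
    by_cases h : ExtActive inferInstance ends F e <;> simp [h, Set.ncard_univ]

lemma act_clones [Finite V] [DecidableEq E] [DecidableEq (E ×ₗ Fin t)]
    [LinearOrder E] {ends : E → Sym2 V} {F : Finset E} {l : E → ℕ} (hF : IsForest ends F)
    (hl : ∀ e ∈ F, 1 ≤ l e ∧ l e ≤ t) :
    act (inferInstance : LinearOrder (E ×ₗ Fin t)) (ends ∘ cloneProj) (clones t F l) + F.card
      = t * act inferInstance ends F + ∑ e ∈ F, l e := by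
  classical
  have h := Finset.sum_congr (rfl : (Finset.univ : Finset E) = Finset.univ)
    fun e _ => card_extActive_clones hF hl e
  simp only [Finset.sum_add_distrib, ← Finset.mul_sum, Finset.sum_ite_mem, Finset.univ_inter,
    Finset.sum_const, smul_eq_mul, mul_one] at h
  convert h using 3
  · unfold act
    rw [← Nat.card_coe_set_eq]
    simp only [← Nat.card_coe_set_eq]
    rw [← Nat.card_sigma]
    exact Nat.card_congr
      { toFun := fun p => ⟨(ofLex p.1).1, (ofLex p.1).2, p.2⟩
        invFun := fun s => ⟨toLex (s.1, s.2.1), s.2.2⟩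
        left_inv := fun _ => rfl
        right_inv := fun _ => rfl }
  · unfold act
    rw [← Nat.card_coe_set_eq]
    simp only [← Nat.card_coe_set_eq]
    rw [← Nat.card_sigma]
    exact Nat.card_congr
      { toFun := fun p => ⟨p.1, (), p.2⟩
        invFun := fun s => ⟨s.1, s.2.2⟩
        left_inv := fun _ => rfl
        right_inv := fun _ => rfl }

lemma clones_labels_injective {ends : E → Sym2 V} [DecidableEq E] :
    Function.Injective fun F : LabeledForest ends t => clones t F.val.1 F.val.2 := by
  rintro ⟨⟨F, l⟩, -, hl, hl0⟩ ⟨⟨F', l'⟩, -, hl', hl0'⟩ (h : clones t F l = clones t F' l')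
  dsimp only at hl hl0 hl' hl0'
  have hFF : F = F' := by rw [← image_clones hl, h, image_clones hl']
  subst hFF
  suffices l = l' by subst this; rfl
  funext e
  by_cases he : e ∈ F
  · obtain ⟨h1, h2⟩ := hl e he
    have hmem : toLex (e, (⟨l e - 1, by omega⟩ : Fin t)) ∈ clones t F l :=
      mem_clones.2 ⟨he, Nat.sub_add_cancel h1⟩
    rw [h] at hmem
    exact (Nat.sub_add_cancel h1).symm.trans (mem_clones.1 hmem).2
  · exact (hl0 e he).trans (hl0' e he).symm

lemma exists_clones_eq [Finite V] {ends : E → Sym2 V} [DecidableEq E] {B : Finset (E ×ₗ Fin t)}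
    (hB : IsForest (ends ∘ cloneProj) B) :
    ∃ F : LabeledForest ends t, clones t F.val.1 F.val.2 = B := by
  classical
  have hinj := hB.injOn_of_comp
  let l : E → ℕ := fun e => ∑ p ∈ B with cloneProj p = e, ((ofLex p).2 + 1 : ℕ)
  have hl : ∀ p ∈ B, l (ofLex p).1 = (ofLex p).2 + 1 := by
    intro p hp
    have : B.filter (fun q => cloneProj q = (ofLex p).1) = {p} := by
      ext q
      simp only [Finset.mem_filter, Finset.mem_singleton]
      exact ⟨fun h => hinj h.1 hp h.2, by rintro rfl; exact ⟨hp, rfl⟩⟩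
    simp only [l, this, Finset.sum_singleton]
  refine ⟨⟨(B.image cloneProj, l), (isForest_comp_iff hinj).1 hB, ?_, ?_⟩, ?_⟩
  · refine Finset.forall_mem_image.2 fun p hp => ?_
    have := hl p hp
    have := (ofLex p).2.isLt
    simp only [cloneProj]
    omega
  · intro e he
    refine Finset.sum_eq_zero fun p hp => absurd ?_ he
    rw [Finset.mem_filter] at hp
    exact hp.2 ▸ Finset.mem_image_of_mem _ hp.1
  · ext p
    rw [mem_clones]
    constructor
    · rintro ⟨hp, h⟩
      obtain ⟨q, hq, hqp⟩ := Finset.mem_image.1 hp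
      have h1 : (ofLex q).1 = (ofLex p).1 := hqp
      have h2 := hl q hq
      rw [h1] at h2
      have h3 : (ofLex q).2 = (ofLex p).2 := Fin.ext (Nat.succ_injective (h2.symm.trans h.symm))
      rwa [← ofLex.injective (Prod.ext h1 h3 : ofLex q = ofLex p)]
    · exact fun hp => ⟨Finset.mem_image_of_mem cloneProj hp, (hl p hp).symm⟩

end Labels

/-- Let `G` be a finite multigraph with a linear order on its
edges and `t ≥ 1`. The graph `Ĝ` has edge set `E ×ₗ Fin t` (the clone `e_i`,
`i = 0,…,t-1`, represents the `i+1`-st copy of `e`, with the same endpoints),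
ordered lexicographically. The map sending a `t`-labeled forest `F` (with label
`ℓ(e)` on `e ∈ F`) to `F' = {e_{ℓ(e)} : e ∈ F}` is a bijection between the
`t`-labeled forests of `G` and the subforests of `Ĝ`, and
`act_Ĝ(F') = t·act_G(F) + ω(F) - |F|` (stated as
`act_Ĝ(F') + |F| = t·act_G(F) + ω(F)`). In particular, the number of
`t`-labeled forests of `G` equals the number of subforests of `Ĝ`. -/
theorem labeledForest_bij_subforests_hat {V E : Type} [Finite V] [Fintype E]
    [DecidableEq E] [LinearOrder E] (ends : E → Sym2 V) (t : ℕ) (ht : 1 ≤ t) :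
    letI hatEnds : (E ×ₗ Fin t) → Sym2 V := fun p => ends (ofLex p).1
    letI Φ : LabeledForest ends t → Finset (E ×ₗ Fin t) := fun F =>
      Finset.univ.filter fun p =>
        (ofLex p).1 ∈ F.val.1 ∧ ((ofLex p).2 : ℕ) + 1 = F.val.2 (ofLex p).1
    (∀ F, IsForest hatEnds (Φ F)) ∧
    Function.Injective Φ ∧
    (∀ B : Finset (E ×ₗ Fin t), IsForest hatEnds B → ∃ F, Φ F = B) ∧
    (∀ F : LabeledForest ends t,
      act inferInstance hatEnds (Φ F) + F.edges.card
        = t * act inferInstance ends F.edges + weight F) ∧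
    Nat.card (LabeledForest ends t)
      = Nat.card {B : Finset (E ×ₗ Fin t) // IsForest hatEnds B} := by
  have hforest : ∀ F : LabeledForest ends t,
      IsForest (ends ∘ cloneProj) (clones t F.val.1 F.val.2) := fun F =>
    (isForest_comp_iff (clones_injOn _ _)).2 (by rw [image_clones F.2.2.1]; exact F.2.1)
  refine ⟨hforest, clones_labels_injective, fun B hB => exists_clones_eq hB,
    fun F => act_clones F.2.1 F.2.2.1, Nat.card_congr (Equiv.ofBijective
      (fun F => ⟨clones t F.val.1 F.val.2, hforest F⟩) ⟨fun F F' h => ?_, fun B => ?_⟩)⟩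
  · exact clones_labels_injective (congrArg Subtype.val h)
  · obtain ⟨F, hF⟩ := exists_clones_eq B.2
    exact ⟨F, Subtype.ext hF⟩

end ForestAlg
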